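/- Moderate deviation converse for quantum hypothesis testing: Let ρ, σ be density operators on ℂ^d with supp ρ ⊆ supp σ and relative entropy variance V := V(ρ‖σ) satisfying 0 < V < +∞, and let (a_n) be a sequence of reals with a_n → 0 and a_n·√n → +∞. With r_n := D(ρ‖σ) − a_n, one has liminf_{n→∞} (1/(n·a_n²))·log α̂_{exp(−n·r_n)}(ρ^{⊗n} ‖ σ^{⊗n}) ≥ −1/(2V). -/

import Mathlib

open scoped BigOperators ComplexOrder
open Filter

noncomputable section

namespace MDQ

/-- Functional calculus for Hermitian matrices (junk value `0` otherwise). -/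
noncomputable def matFun {d : ℕ} (f : ℝ → ℝ) (A : Matrix (Fin d) (Fin d) ℂ) :
    Matrix (Fin d) (Fin d) ℂ :=
  if hA : A.IsHermitian then hA.cfc f else 0

/-- Matrix logarithm on the support (`Real.log 0 = 0`). -/
noncomputable def mlog {d : ℕ} (A : Matrix (Fin d) (Fin d) ℂ) : Matrix (Fin d) (Fin d) ℂ :=
  matFun Real.log A

/-- Matrix real power, restricted to the support. -/
noncomputable def mpow {d : ℕ} (A : Matrix (Fin d) (Fin d) ℂ) (p : ℝ) :
    Matrix (Fin d) (Fin d) ℂ :=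
  matFun (fun t => if t = 0 then 0 else t ^ p) A

/-- Matrix exponential via functional calculus. -/
noncomputable def mexp {d : ℕ} (A : Matrix (Fin d) (Fin d) ℂ) : Matrix (Fin d) (Fin d) ℂ :=
  matFun Real.exp A

/-- Orthogonal projection onto the support of a Hermitian matrix. -/
noncomputable def suppProj {d : ℕ} (A : Matrix (Fin d) (Fin d) ℂ) : Matrix (Fin d) (Fin d) ℂ :=
  matFun (fun t => if t = 0 then 0 else 1) A

/-- `A` is a density operator. -/
def IsDensity {d : ℕ} (A : Matrix (Fin d) (Fin d) ℂ) : Prop :=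
  A.PosSemidef ∧ A.trace = 1

/-- Real part of the trace. -/
noncomputable def reTr {ι : Type} [Fintype ι] (A : Matrix ι ι ℂ) : ℝ :=
  A.trace.re

/-- supp ρ ⊆ supp σ, phrased via ranges of the associated linear maps. -/
def SuppLE {d : ℕ} (ρ σ : Matrix (Fin d) (Fin d) ℂ) : Prop :=
  LinearMap.range (Matrix.toLin' ρ) ≤ LinearMap.range (Matrix.toLin' σ)

/-- Quantum relative entropy `D(ρ‖σ)`. -/
noncomputable def qD {d : ℕ} (ρ σ : Matrix (Fin d) (Fin d) ℂ) : ℝ :=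
  reTr (ρ * (mlog ρ - mlog σ))

/-- Quantum relative entropy variance `V(ρ‖σ)`. -/
noncomputable def qV {d : ℕ} (ρ σ : Matrix (Fin d) (Fin d) ℂ) : ℝ :=
  reTr (ρ * (mlog ρ - mlog σ) ^ 2) - (qD ρ σ) ^ 2

/-- The variant relative entropy variance `Ṽ(ρ‖σ)`. -/
noncomputable def qVtilde {d : ℕ} (ρ σ : Matrix (Fin d) (Fin d) ℂ) : ℝ :=
  (∫ t in (0:ℝ)..1,
    reTr (mpow ρ (1 - t) * (mlog ρ - mlog σ) * mpow ρ t * (mlog ρ - mlog σ))) - (qD ρ σ) ^ 2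

/-- The quantum Rényi divergence of order zero, `D₀(ρ‖σ) = -log Tr[Π_ρ σ]`. -/
noncomputable def qD0 {d : ℕ} (ρ σ : Matrix (Fin d) (Fin d) ℂ) : ℝ :=
  - Real.log (reTr (suppProj ρ * σ))

/-- Tensor product of a finite family of `d × d` matrices. -/
noncomputable def tensorSeq {d n : ℕ} (A : Fin n → Matrix (Fin d) (Fin d) ℂ) :
    Matrix (Fin n → Fin d) (Fin n → Fin d) ℂ :=
  Matrix.of fun i j => ∏ k, A k (i k) (j k)

/-- `n`-fold tensor power of a matrix. -/
noncomputable def tensorPow {d : ℕ} (A : Matrix (Fin d) (Fin d) ℂ) (n : ℕ) :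
    Matrix (Fin n → Fin d) (Fin n → Fin d) ℂ :=
  tensorSeq (fun _ => A)

/-- Smallest type-I error with type-II error at most `μ`:  `α̂_μ(ρ‖σ)`. -/
noncomputable def hypoErr {ι : Type} [Fintype ι] [DecidableEq ι]
    (ρ σ : Matrix ι ι ℂ) (μ : ℝ) : ℝ :=
  sInf { a : ℝ | ∃ Q : Matrix ι ι ℂ, Q.PosSemidef ∧ (1 - Q).PosSemidef ∧
    reTr (Q * σ) ≤ μ ∧ a = reTr ((1 - Q) * ρ) }

/-- `P` is a probability distribution on a finite alphabet. -/
def IsProbDist {X : Type} [Fintype X] (P : X → ℝ) : Prop :=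
  (∀ x, 0 ≤ P x) ∧ ∑ x, P x = 1

/-- The average output state `PW`. -/
noncomputable def avgState {X : Type} [Fintype X] {d : ℕ}
    (P : X → ℝ) (W : X → Matrix (Fin d) (Fin d) ℂ) : Matrix (Fin d) (Fin d) ℂ :=
  ∑ x, (P x : ℂ) • W x

/-- Mutual information `I(P, W)`. -/
noncomputable def mutualInfo {X : Type} [Fintype X] {d : ℕ}
    (P : X → ℝ) (W : X → Matrix (Fin d) (Fin d) ℂ) : ℝ :=
  ∑ x, P x * qD (W x) (avgState P W)

/-- Capacity `C_W`. -/
noncomputable def capacity {X : Type} [Fintype X] {d : ℕ}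
    (W : X → Matrix (Fin d) (Fin d) ℂ) : ℝ :=
  sSup { c : ℝ | ∃ P : X → ℝ, IsProbDist P ∧ c = mutualInfo P W }

/-- Conditional information variance `V(P, W)`. -/
noncomputable def infoVar {X : Type} [Fintype X] {d : ℕ}
    (P : X → ℝ) (W : X → Matrix (Fin d) (Fin d) ℂ) : ℝ :=
  ∑ x, P x * qV (W x) (avgState P W)

/-- The variant conditional information variance `Ṽ(P, W)`. -/
noncomputable def infoVarTilde {X : Type} [Fintype X] {d : ℕ}
    (P : X → ℝ) (W : X → Matrix (Fin d) (Fin d) ℂ) : ℝ :=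
  ∑ x, P x * qVtilde (W x) (avgState P W)

/-- Minimal peripheral information variance `V_W`. -/
noncomputable def Vmin {X : Type} [Fintype X] {d : ℕ}
    (W : X → Matrix (Fin d) (Fin d) ℂ) : ℝ :=
  sInf { v : ℝ | ∃ P : X → ℝ, IsProbDist P ∧ mutualInfo P W = capacity W ∧ v = infoVar P W }

/-- Minimal variant peripheral information variance `Ṽ_W`. -/
noncomputable def VminTilde {X : Type} [Fintype X] {d : ℕ}
    (W : X → Matrix (Fin d) (Fin d) ℂ) : ℝ :=
  sInf { v : ℝ | ∃ P : X → ℝ, IsProbDist P ∧ mutualInfo P W = capacity W ∧ v = infoVarTilde P W }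

/-- Conditional relative entropy `D(W‖σ|P)`. -/
noncomputable def Dcond {X : Type} [Fintype X] {d : ℕ}
    (W : X → Matrix (Fin d) (Fin d) ℂ) (σ : Matrix (Fin d) (Fin d) ℂ) (P : X → ℝ) : ℝ :=
  ∑ x, P x * qD (W x) σ

/-- Conditional relative entropy variance `V(W‖σ|P)`. -/
noncomputable def Vcond {X : Type} [Fintype X] {d : ℕ}
    (W : X → Matrix (Fin d) (Fin d) ℂ) (σ : Matrix (Fin d) (Fin d) ℂ) (P : X → ℝ) : ℝ :=
  ∑ x, P x * qV (W x) σ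

/-- Conditional order-zero Rényi divergence `D₀(W‖σ|P)`. -/
noncomputable def D0cond {X : Type} [Fintype X] {d : ℕ}
    (W : X → Matrix (Fin d) (Fin d) ℂ) (σ : Matrix (Fin d) (Fin d) ℂ) (P : X → ℝ) : ℝ :=
  ∑ x, P x * qD0 (W x) σ

/-- The exponent function `E_h(s, P, σ)`. -/
noncomputable def Eh {X : Type} [Fintype X] {d : ℕ}
    (W : X → Matrix (Fin d) (Fin d) ℂ) (s : ℝ) (P : X → ℝ)
    (σ : Matrix (Fin d) (Fin d) ℂ) : ℝ :=
  -(1 + s) * ∑ x, P x * Real.log (reTr (mpow (W x) (1 / (1 + s)) * mpow σ (s / (1 + s))))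

/-- The log-Euclidean exponent function `Ẽ_h(s, P, σ)`. -/
noncomputable def EhTilde {X : Type} [Fintype X] {d : ℕ}
    (W : X → Matrix (Fin d) (Fin d) ℂ) (s : ℝ) (P : X → ℝ)
    (σ : Matrix (Fin d) (Fin d) ℂ) : ℝ :=
  -(1 + s) * ∑ x, P x *
    Real.log (reTr (mexp ((((1 + s)⁻¹ : ℝ) : ℂ) • (mlog (W x) + ((s : ℝ) : ℂ) • mlog σ))))

/-- The modified auxiliary function `Ẽ₀(s, P, σ)`. -/
noncomputable def E0Tilde {X : Type} [Fintype X] {d : ℕ}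
    (W : X → Matrix (Fin d) (Fin d) ℂ) (s : ℝ) (P : X → ℝ)
    (σ : Matrix (Fin d) (Fin d) ℂ) : ℝ :=
  - Real.log (∑ x, P x * reTr (mpow (W x) (1 - s) * mpow σ s))

/-- The sphere-packing exponent `E_sp^{(2)}(R, P, σ)`. -/
noncomputable def Esp2 {X : Type} [Fintype X] {d : ℕ}
    (W : X → Matrix (Fin d) (Fin d) ℂ) (R : ℝ) (P : X → ℝ)
    (σ : Matrix (Fin d) (Fin d) ℂ) : ℝ :=
  sSup { e : ℝ | ∃ s : ℝ, 0 ≤ s ∧ e = Eh W s P σ - s * R }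

/-- The sphere-packing exponent `Ẽ_sp(R, P, σ)`. -/
noncomputable def EspTilde {X : Type} [Fintype X] {d : ℕ}
    (W : X → Matrix (Fin d) (Fin d) ℂ) (R : ℝ) (P : X → ℝ)
    (σ : Matrix (Fin d) (Fin d) ℂ) : ℝ :=
  sSup { e : ℝ | ∃ s : ℝ, 0 ≤ s ∧ e = EhTilde W s P σ - s * R }

open Classical in
/-- Empirical distribution of a word `x^n ∈ X^n`. -/
noncomputable def empDist {X : Type} [Fintype X] {n : ℕ} (xs : Fin n → X) (x : X) : ℝ :=
  ((Finset.univ.filter fun i => xs i = x).card : ℝ) / n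

/-- Smallest average error probability `ε*(n, R)` over all `n`-blocklength codes with
`⌈exp (n R)⌉` messages. -/
noncomputable def optErr {X : Type} [Fintype X] {d : ℕ}
    (W : X → Matrix (Fin d) (Fin d) ℂ) (n : ℕ) (R : ℝ) : ℝ :=
  sInf { e : ℝ | ∃ (f : Fin ⌈Real.exp (n * R)⌉₊ → Fin n → X)
    (Pov : Fin ⌈Real.exp (n * R)⌉₊ → Matrix (Fin n → Fin d) (Fin n → Fin d) ℂ),
    (∀ m, (Pov m).PosSemidef) ∧ (∑ m, Pov m) = 1 ∧
    e = (1 / (⌈Real.exp (n * R)⌉₊ : ℝ)) *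
      ∑ m, (1 - reTr (Pov m * tensorSeq (fun k => W (f m k)))) }

/-- The binary entropy function. -/
noncomputable def binEnt (p : ℝ) : ℝ :=
  -p * Real.log p - (1 - p) * Real.log (1 - p)

section LargeDeviations

variable {Ω : Type} [Fintype Ω]

/-- Moment generating function of `X` under the weights `w`. -/
def wmgf (w X : Ω → ℝ) (s : ℝ) : ℝ := ∑ x, w x * Real.exp (s * X x)

lemma wmgf_nonneg {w : Ω → ℝ} (hw : ∀ x, 0 ≤ w x) (X : Ω → ℝ) (s : ℝ) : 0 ≤ wmgf w X s :=
  Finset.sum_nonneg fun x _ => mul_nonneg (hw x) (Real.exp_pos _).le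

lemma wmgf_pow (w X : Ω → ℝ) (s : ℝ) (n : ℕ) :
    wmgf w X s ^ n = ∑ ω : Fin n → Ω, (∏ k, w (ω k)) * Real.exp (s * ∑ k, X (ω k)) := by
  unfold wmgf
  rw [Finset.sum_pow', Fintype.piFinset_univ]
  refine Finset.sum_congr rfl fun ω _ => ?_
  rw [Finset.prod_mul_distrib, Finset.mul_sum, Real.exp_sum]

open Classical in
/-- Weight of the event `c ≤ ∑ k, X (ω k)` under the `n`-fold product of `w`. -/
def tailWeight (w X : Ω → ℝ) (n : ℕ) (c : ℝ) : ℝ :=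
  ∑ ω : Fin n → Ω, if c ≤ ∑ k, X (ω k) then ∏ k, w (ω k) else 0

lemma le_tailWeight {w : Ω → ℝ} (hw : ∀ x, 0 ≤ w x) (X : Ω → ℝ) (n : ℕ) {l s : ℝ} (hl : 0 ≤ l)
    (hs : 0 ≤ s) (c b : ℝ) :
    Real.exp (-(l * b)) * (wmgf w X l ^ n - Real.exp (s * c) * wmgf w X (l - s) ^ n
      - Real.exp (-(s * b)) * wmgf w X (l + s) ^ n) ≤ tailWeight w X n c := by
  simp only [wmgf_pow, tailWeight]
  rw [Finset.mul_sum, Finset.mul_sum, ← Finset.sum_sub_distrib, ← Finset.sum_sub_distrib,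
    Finset.mul_sum]
  refine Finset.sum_le_sum fun ω _ => ?_
  have hP : 0 ≤ ∏ k, w (ω k) := Finset.prod_nonneg fun k _ => hw _
  set P := ∏ k, w (ω k)
  set S := ∑ k, X (ω k)
  have e : Real.exp (-(l * b)) * (P * Real.exp (l * S) - Real.exp (s * c) * (P * Real.exp ((l - s) * S))
      - Real.exp (-(s * b)) * (P * Real.exp ((l + s) * S)))
      = P * (Real.exp (l * (S - b)) * (1 - Real.exp (s * (c - S)) - Real.exp (s * (S - b)))) := by
    have e1 : Real.exp (l * (S - b)) = Real.exp (-(l * b)) * Real.exp (l * S) := by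
      rw [← Real.exp_add]; ring_nf
    have e2 : Real.exp (s * (c - S)) = Real.exp (s * c) * Real.exp (-(s * S)) := by
      rw [← Real.exp_add]; ring_nf
    have e3 : Real.exp (s * (S - b)) = Real.exp (-(s * b)) * Real.exp (s * S) := by
      rw [← Real.exp_add]; ring_nf
    have e4 : Real.exp ((l - s) * S) = Real.exp (l * S) * Real.exp (-(s * S)) := by
      rw [← Real.exp_add]; ring_nf
    have e5 : Real.exp ((l + s) * S) = Real.exp (l * S) * Real.exp (s * S) := by
      rw [← Real.exp_add]; ring_nf
    rw [e1, e2, e3, e4, e5]; ring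
  rw [e]
  have p1 := Real.exp_pos (l * (S - b))
  have p2 := Real.exp_pos (s * (c - S))
  have p3 := Real.exp_pos (s * (S - b))
  split_ifs with h
  · refine mul_le_of_le_one_right hP ?_
    rcases le_total S b with hb | hb
    · have : Real.exp (l * (S - b)) ≤ 1 :=
        Real.exp_le_one_iff.2 (mul_nonpos_of_nonneg_of_nonpos hl (by linarith))
      nlinarith
    · have : 1 ≤ Real.exp (s * (S - b)) := Real.one_le_exp (mul_nonneg hs (by linarith))
      nlinarith
  · have : 1 ≤ Real.exp (s * (c - S)) := Real.one_le_exp (mul_nonneg hs (by linarith))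
    exact mul_nonpos_of_nonneg_of_nonpos hP
      (mul_nonpos_of_nonneg_of_nonpos p1.le (by linarith))

lemma abs_exp_sub_quadratic_le {x : ℝ} (hx : |x| ≤ 1) :
    |Real.exp x - (1 + x + x ^ 2 / 2)| ≤ |x| ^ 3 := by
  have h := Real.exp_bound hx (n := 3) (by norm_num)
  simp only [Finset.sum_range_succ, Finset.sum_range_zero, Nat.factorial] at h
  norm_num at h
  have : 0 ≤ |x| ^ 3 := by positivity
  linarith

lemma exists_abs_wmgf_sub_le {w X : Ω → ℝ} {V : ℝ} (hw : ∀ x, 0 ≤ w x) (h1 : ∑ x, w x = 1)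
    (hX : ∑ x, w x * X x = 0) (hV : ∑ x, w x * X x ^ 2 = V) :
    ∃ K : ℝ, 0 < K ∧ ∀ s : ℝ, |s| * K ≤ 1 →
      |wmgf w X s - (1 + V / 2 * s ^ 2)| ≤ K ^ 3 * |s| ^ 3 := by
  refine ⟨1 + ∑ x, |X x|, by positivity, fun s hs => ?_⟩
  set K := 1 + ∑ x, |X x| with hKdef
  have hK : ∀ x, |X x| ≤ K := fun x => by
    have := Finset.single_le_sum (f := fun x => |X x|) (fun i _ => abs_nonneg _) (Finset.mem_univ x)
    linarith
  have e : wmgf w X s - (1 + V / 2 * s ^ 2)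
      = ∑ x, w x * (Real.exp (s * X x) - (1 + s * X x + (s * X x) ^ 2 / 2)) := by
    have : ∑ x, w x * (1 + s * X x + (s * X x) ^ 2 / 2) = 1 + V / 2 * s ^ 2 := by
      calc _ = ∑ x, w x + s * ∑ x, w x * X x + s ^ 2 / 2 * ∑ x, w x * X x ^ 2 := by
            simp only [Finset.mul_sum, ← Finset.sum_add_distrib]
            exact Finset.sum_congr rfl fun x _ => by ring
        _ = _ := by rw [h1, hX, hV]; ring
    simp only [mul_sub, Finset.sum_sub_distrib, this]
    rfl
  rw [e]
  calc _ ≤ ∑ x, |w x * (Real.exp (s * X x) - (1 + s * X x + (s * X x) ^ 2 / 2))| :=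
        Finset.abs_sum_le_sum_abs _ _
    _ ≤ ∑ x, w x * (K ^ 3 * |s| ^ 3) := by
        refine Finset.sum_le_sum fun x _ => ?_
        rw [abs_mul, abs_of_nonneg (hw x)]
        refine mul_le_mul_of_nonneg_left ?_ (hw x)
        have hsx : |s * X x| ≤ |s| * K := by
          rw [abs_mul]; exact mul_le_mul_of_nonneg_left (hK x) (abs_nonneg s)
        refine (abs_exp_sub_quadratic_le (hsx.trans hs)).trans ?_
        calc |s * X x| ^ 3 ≤ (|s| * K) ^ 3 := by gcongr
          _ = _ := by ring
    _ = _ := by rw [← Finset.sum_mul, h1, one_mul]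

lemma eventually_wmgf_bounds {w X : Ω → ℝ} {V : ℝ} (hw : ∀ x, 0 ≤ w x) (h1 : ∑ x, w x = 1)
    (hX : ∑ x, w x * X x = 0) (hV : ∑ x, w x * X x ^ 2 = V) {ε : ℝ} (hε : 0 < ε) :
    ∀ᶠ s in nhds (0 : ℝ), Real.exp ((V / 2 - ε) * s ^ 2) ≤ wmgf w X s ∧
      wmgf w X s ≤ Real.exp ((V / 2 + ε) * s ^ 2) := by
  obtain ⟨K, hK, h⟩ := exists_abs_wmgf_sub_le hw h1 hX hV
  have small : ∀ (f : ℝ → ℝ), Continuous f → f 0 = 0 → ∀ c > 0, ∀ᶠ s in nhds (0 : ℝ), f s ≤ c := by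
    intro f hf h0 c hc
    have := hf.tendsto 0
    rw [h0] at this
    exact (this.eventually (gt_mem_nhds hc)).mono fun _ => le_of_lt
  filter_upwards [small (fun s => |s| * K) (by fun_prop) (by simp) 1 one_pos,
    small (fun s => K ^ 3 * |s|) (by fun_prop) (by simp) (ε / 2) (by positivity),
    small (fun s => |(V / 2 - ε) * s ^ 2|) (by fun_prop) (by simp) 1 one_pos,
    small (fun s => (V / 2 - ε) ^ 2 * s ^ 2) (by fun_prop) (by simp) (ε / 2) (by positivity)]
    with s a1 a2 a3 a4
  have hs := abs_le.1 (h s a1)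
  have hc : K ^ 3 * |s| ^ 3 ≤ ε / 2 * s ^ 2 := by
    calc K ^ 3 * |s| ^ 3 = (K ^ 3 * |s|) * s ^ 2 := by rw [← sq_abs s]; ring
      _ ≤ _ := by gcongr
  have hq : ((V / 2 - ε) * s ^ 2) ^ 2 ≤ ε / 2 * s ^ 2 := by
    calc _ = ((V / 2 - ε) ^ 2 * s ^ 2) * s ^ 2 := by ring
      _ ≤ _ := by gcongr
  constructor
  · have := abs_le.1 (Real.abs_exp_sub_one_sub_id_le a3)
    linarith
  · have := Real.add_one_le_exp ((V / 2 + ε) * s ^ 2)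
    have : 0 ≤ s ^ 2 := sq_nonneg s
    nlinarith

lemma eventually_exp_le_tailWeight {w X : Ω → ℝ} {V : ℝ} (hw : ∀ x, 0 ≤ w x) (h1 : ∑ x, w x = 1)
    (hX : ∑ x, w x * X x = 0) (hV : ∑ x, w x * X x ^ 2 = V) (hVpos : 0 < V) {y : ℕ → ℝ}
    (hy : Tendsto y atTop (nhds 0)) (hpos : ∀ᶠ n in atTop, 0 < y n)
    (hny : Tendsto (fun n : ℕ => n * y n ^ 2) atTop atTop) {δ : ℝ} (hδ : 0 < δ) (hδ1 : δ ≤ 1) :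
    ∀ᶠ n in atTop, Real.exp (-(n * y n ^ 2 / V * (1 / 2 + 5 * δ))) ≤ tailWeight w X n (n * y n) := by
  obtain ⟨κ, hκ⟩ : ∃ κ, δ ^ 2 = 26 * κ := ⟨δ ^ 2 / 26, by ring⟩
  have hκpos : 0 < κ := by have := pow_pos hδ 2; linarith
  have hδsq : δ ^ 2 ≤ δ := by rw [sq]; exact mul_le_of_le_one_right hδ.le hδ1
  have hb := eventually_wmgf_bounds hw h1 hX hV (ε := V * κ / 2) (by positivity)
  have ht : ∀ c : ℝ, Tendsto (fun n => c * y n / V) atTop (nhds 0) := fun c => by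
    simpa using (hy.const_mul c).div_const V
  filter_upwards [hpos, (ht (1 + δ)).eventually hb, (ht 1).eventually hb,
    (ht (1 + 2 * δ)).eventually hb,
    hny.eventually_ge_atTop (V * (Real.log 4 / (δ ^ 2 / 4))),
    hny.eventually_ge_atTop (V * (Real.log 2 / δ))] with n hyn b1 b2 b3 hbig hbig2
  set T := n * y n ^ 2 / V with hT
  have hT0 : 0 ≤ T := by positivity
  have hTa : Real.log 4 ≤ T * (δ ^ 2 / 4) := by
    rw [← div_le_iff₀ (by positivity), hT, le_div_iff₀ hVpos]; linarith
  have hTb : Real.log 2 ≤ T * δ := by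
    rw [← div_le_iff₀ (by positivity), hT, le_div_iff₀ hVpos]; linarith
  have key := le_tailWeight hw X n (l := (1 + δ) * y n / V) (s := δ * y n / V) (by positivity)
    (by positivity) (n * y n) (n * ((1 + 2 * δ) * y n))
  have r1 : (1 + δ) * y n / V - δ * y n / V = 1 * y n / V := by ring
  have r2 : (1 + δ) * y n / V + δ * y n / V = (1 + 2 * δ) * y n / V := by ring
  rw [r1, r2] at key
  have m1 : Real.exp (T * ((1 + δ) ^ 2 * (1 - κ) / 2)) ≤ wmgf w X ((1 + δ) * y n / V) ^ n := by
    refine le_trans (le_of_eq ?_) (pow_le_pow_left₀ (Real.exp_pos _).le b1.1 n)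
    rw [← Real.exp_nat_mul, hT]; congr 1; field_simp
  have m2 : wmgf w X (1 * y n / V) ^ n ≤ Real.exp (T * ((1 + κ) / 2)) := by
    refine le_trans (pow_le_pow_left₀ (wmgf_nonneg hw X _) b2.2 n) (le_of_eq ?_)
    rw [← Real.exp_nat_mul, hT]; congr 1; field_simp
  have m3 : wmgf w X ((1 + 2 * δ) * y n / V) ^ n ≤ Real.exp (T * ((1 + 2 * δ) ^ 2 * (1 + κ) / 2)) := by
    refine le_trans (pow_le_pow_left₀ (wmgf_nonneg hw X _) b3.2 n) (le_of_eq ?_)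
    rw [← Real.exp_nat_mul, hT]; congr 1; field_simp
  set E := Real.exp (T * ((1 + δ) ^ 2 * (1 - κ) / 2)) with hE
  have hquart : ∀ u : ℝ, u ≤ (1 + δ) ^ 2 * (1 - κ) / 2 - δ ^ 2 / 4 → Real.exp (T * u) ≤ E / 4 := by
    intro u hu
    have e4 : E / 4 = Real.exp (T * ((1 + δ) ^ 2 * (1 - κ) / 2) - Real.log 4) := by
      rw [Real.exp_sub, Real.exp_log (by norm_num)]
    rw [e4]
    refine Real.exp_le_exp.2 ?_
    have := mul_le_mul_of_nonneg_left hu hT0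
    linarith
  have hδκ : κ * δ ≤ κ := mul_le_of_le_one_right hκpos.le hδ1
  have hδκ2 : κ * δ ^ 2 ≤ κ := mul_le_of_le_one_right hκpos.le (by linarith)
  have q2 : Real.exp (δ * y n / V * (n * y n)) * wmgf w X (1 * y n / V) ^ n ≤ E / 4 := by
    calc _ ≤ Real.exp (δ * y n / V * (n * y n)) * Real.exp (T * ((1 + κ) / 2)) := by gcongr
      _ = Real.exp (T * (δ + (1 + κ) / 2)) := by
        rw [← Real.exp_add, hT]; congr 1; ring
      _ ≤ _ := hquart _ (by linarith)
  have q3 : Real.exp (-(δ * y n / V * (n * ((1 + 2 * δ) * y n)))) * wmgf w X ((1 + 2 * δ) * y n / V) ^ n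
      ≤ E / 4 := by
    calc _ ≤ Real.exp (-(δ * y n / V * (n * ((1 + 2 * δ) * y n)))) *
          Real.exp (T * ((1 + 2 * δ) ^ 2 * (1 + κ) / 2)) := by gcongr
      _ = Real.exp (T * (-(δ * (1 + 2 * δ)) + (1 + 2 * δ) ^ 2 * (1 + κ) / 2)) := by
        rw [← Real.exp_add, hT]; congr 1; ring
      _ ≤ _ := hquart _ (by linarith)
  refine le_trans ?_ key
  calc Real.exp (-(T * (1 / 2 + 5 * δ)))
      ≤ Real.exp (-(T * ((1 + δ) * (1 + 2 * δ))) + T * ((1 + δ) ^ 2 * (1 - κ) / 2) - Real.log 2) := by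
        refine Real.exp_le_exp.2 ?_
        have : 0 ≤ T * (1 / 2 + 4 * δ - (1 + δ) * (1 + 2 * δ) + (1 + δ) ^ 2 * (1 - κ) / 2) :=
          mul_nonneg hT0 (by linarith)
        linarith
    _ = Real.exp (-(T * ((1 + δ) * (1 + 2 * δ)))) * (E / 2) := by
        rw [Real.exp_sub, Real.exp_add, Real.exp_log (by norm_num)]; ring
    _ = Real.exp (-((1 + δ) * y n / V * (n * ((1 + 2 * δ) * y n)))) * (E / 2) := by
        rw [hT]; congr 3; ring
    _ ≤ _ := by
        refine mul_le_mul_of_nonneg_left ?_ (Real.exp_pos _).le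
        linarith

end LargeDeviations

section Spectral

open Matrix

variable {ι : Type} [Fintype ι] [DecidableEq ι]

/-- The matrix with eigenvector matrix `U` and eigenvalues `l`. -/
def conjDiag (U : Matrix ι ι ℂ) (l : ι → ℝ) : Matrix ι ι ℂ :=
  U * diagonal (fun i => (l i : ℂ)) * Uᴴ

lemma conjDiag_mul {U : Matrix ι ι ℂ} (hU : U ∈ unitaryGroup ι ℂ) (l f : ι → ℝ) :
    conjDiag U l * conjDiag U f = conjDiag U (fun i => l i * f i) := by
  have h : Uᴴ * U = 1 := mem_unitaryGroup_iff'.1 hU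
  calc conjDiag U l * conjDiag U f
      = U * diagonal (fun i => (l i : ℂ)) * (Uᴴ * U) * diagonal (fun i => (f i : ℂ)) * Uᴴ := by
        simp only [conjDiag, Matrix.mul_assoc]
    _ = _ := by
        rw [h, Matrix.mul_one, Matrix.mul_assoc U, diagonal_mul_diagonal]
        simp [conjDiag]

lemma conjDiag_one {U : Matrix ι ι ℂ} (hU : U ∈ unitaryGroup ι ℂ) :
    conjDiag U (fun _ => 1) = 1 := by
  have h : U * Uᴴ = 1 := mem_unitaryGroup_iff.1 hU
  simp [conjDiag, h]

lemma reTr_conjDiag_mul (U B : Matrix ι ι ℂ) (l : ι → ℝ) :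
    reTr (B * conjDiag U l) = ∑ i, l i * ((Uᴴ * B * U) i i).re := by
  have : (B * conjDiag U l).trace = ((Uᴴ * B * U) * diagonal (fun i => (l i : ℂ))).trace := by
    rw [conjDiag, ← Matrix.mul_assoc, trace_mul_comm, ← Matrix.mul_assoc, ← Matrix.mul_assoc]
  rw [reTr, this, trace, Complex.re_sum]
  refine Finset.sum_congr rfl fun i _ => ?_
  rw [diag_apply, mul_diagonal, Complex.re_mul_ofReal, mul_comm]

lemma re_conjTranspose_mul_diagonal_mul (G : Matrix ι ι ℂ) (m : ι → ℝ) (i : ι) :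
    ((Gᴴ * diagonal (fun j => (m j : ℂ)) * G) i i).re = ∑ j, m j * ‖G j i‖ ^ 2 := by
  rw [Matrix.mul_apply, Complex.re_sum]
  refine Finset.sum_congr rfl fun j _ => ?_
  rw [mul_diagonal, conjTranspose_apply, mul_right_comm, Complex.re_mul_ofReal, mul_comm]
  rw [← Complex.normSq_eq_norm_sq, ← Complex.ofReal_re (Complex.normSq _),
    Complex.normSq_eq_conj_mul_self]
  rfl

lemma reTr_conjDiag_mul_conjDiag (U W : Matrix ι ι ℂ) (l m : ι → ℝ) :
    reTr (conjDiag U l * conjDiag W m) = ∑ i, ∑ j, l i * m j * ‖(Wᴴ * U) j i‖ ^ 2 := by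
  rw [reTr, trace_mul_comm, ← reTr, reTr_conjDiag_mul]
  refine Finset.sum_congr rfl fun i _ => ?_
  have : Uᴴ * conjDiag W m * U = (Wᴴ * U)ᴴ * diagonal (fun j => (m j : ℂ)) * (Wᴴ * U) := by
    simp only [conjDiag, conjTranspose_mul, conjTranspose_conjTranspose, Matrix.mul_assoc]
  rw [this, re_conjTranspose_mul_diagonal_mul, Finset.mul_sum]
  exact Finset.sum_congr rfl fun j _ => by ring

lemma reTr_mul_conjDiag_nonneg {B : Matrix ι ι ℂ} (hB : B.PosSemidef) (U : Matrix ι ι ℂ)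
    {l : ι → ℝ} (hl : ∀ i, 0 ≤ l i) : 0 ≤ reTr (B * conjDiag U l) := by
  rw [reTr_conjDiag_mul]
  refine Finset.sum_nonneg fun i _ => mul_nonneg (hl i) ?_
  exact (Complex.le_def.1 (hB.conjTranspose_mul_mul_same U).diag_nonneg).1

/-- `Tr[R A] ≥ ∑ᵢⱼ lᵢ |⟨wⱼ, R uᵢ⟩|²` for an effect `R`. -/
lemma sum_le_reTr_mul_conjDiag {R W : Matrix ι ι ℂ} (hR : R.PosSemidef)
    (hR1 : (1 - R).PosSemidef) (hW : W ∈ unitaryGroup ι ℂ) (U : Matrix ι ι ℂ) {l : ι → ℝ}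
    (hl : ∀ i, 0 ≤ l i) :
    ∑ i, ∑ j, l i * ‖(Wᴴ * R * U) j i‖ ^ 2 ≤ reTr (R * conjDiag U l) := by
  have hWW : W * Wᴴ = 1 := mem_unitaryGroup_iff.1 hW
  have hpos : (R - R * R).PosSemidef := by
    have e : R - R * R = Rᴴ * (1 - R) * R + (1 - R)ᴴ * R * (1 - R) := by
      rw [hR.1, hR1.1]; noncomm_ring
    rw [e]
    exact (hR1.conjTranspose_mul_mul_same R).add (hR.conjTranspose_mul_mul_same (1 - R))
  have h := reTr_mul_conjDiag_nonneg hpos U hl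
  rw [Matrix.sub_mul, reTr, trace_sub, Complex.sub_re, sub_nonneg] at h
  refine le_trans (le_of_eq ?_) h
  rw [← reTr, reTr_conjDiag_mul]
  refine Finset.sum_congr rfl fun i _ => ?_
  have e : Uᴴ * (R * R) * U
      = (Wᴴ * R * U)ᴴ * diagonal (fun _ => ((1 : ℝ) : ℂ)) * (Wᴴ * R * U) := by
    calc Uᴴ * (R * R) * U = Uᴴ * R * (W * Wᴴ) * R * U := by
          rw [hWW]; simp only [Matrix.mul_one, Matrix.mul_assoc]
      _ = _ := by
          simp [conjTranspose_mul, hR.1.eq, Matrix.mul_assoc]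
  rw [e, re_conjTranspose_mul_diagonal_mul, Finset.mul_sum]
  simp

/-- Nussbaum–Szkoła type lower bound on the Bayesian error of a test. -/
lemma sum_min_le_bayesError {Q U W : Matrix ι ι ℂ} (hQ : Q.PosSemidef)
    (hQ1 : (1 - Q).PosSemidef) (hU : U ∈ unitaryGroup ι ℂ) (hW : W ∈ unitaryGroup ι ℂ)
    {l m : ι → ℝ} (hl : ∀ i, 0 ≤ l i) (hm : ∀ i, 0 ≤ m i) {t : ℝ} (ht : 0 ≤ t) :
    1 / 2 * ∑ i, ∑ j, min (l i) (t * m j) * ‖(Wᴴ * U) j i‖ ^ 2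
      ≤ reTr ((1 - Q) * conjDiag U l) + t * reTr (Q * conjDiag W m) := by
  have h1 := sum_le_reTr_mul_conjDiag hQ1 (by simpa using hQ) hW U hl
  have h2 := mul_le_mul_of_nonneg_left (sum_le_reTr_mul_conjDiag hQ hQ1 hU W hm) ht
  refine le_trans ?_ (add_le_add h1 h2)
  rw [Finset.sum_comm (f := fun i j => m i * ‖(Uᴴ * Q * W) j i‖ ^ 2)]
  simp only [Finset.mul_sum, ← Finset.sum_add_distrib]
  refine Finset.sum_le_sum fun i _ => Finset.sum_le_sum fun j _ => ?_
  have hsym : ‖(Uᴴ * Q * W) i j‖ = ‖(Wᴴ * Q * U) j i‖ := by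
    have : Uᴴ * Q * W = (Wᴴ * Q * U)ᴴ := by
      simp [conjTranspose_mul, hQ.1.eq, Matrix.mul_assoc]
    rw [this, conjTranspose_apply, norm_star]
  have hadd : (Wᴴ * U) j i = (Wᴴ * (1 - Q) * U) j i + (Wᴴ * Q * U) j i := by
    rw [← Matrix.add_apply, ← Matrix.add_mul, ← Matrix.mul_add, sub_add_cancel, Matrix.mul_one]
  rw [hsym, hadd]
  set a := (Wᴴ * (1 - Q) * U) j i
  set b := (Wᴴ * Q * U) j i
  have hmin : 0 ≤ min (l i) (t * m j) := le_min (hl i) (mul_nonneg ht (hm j))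
  have hab : ‖a + b‖ ^ 2 ≤ 2 * (‖a‖ ^ 2 + ‖b‖ ^ 2) := by
    have := norm_add_le a b
    nlinarith [norm_nonneg (a + b), sq_nonneg (‖a‖ - ‖b‖)]
  have c1 : min (l i) (t * m j) * ‖a‖ ^ 2 ≤ l i * ‖a‖ ^ 2 := by gcongr; exact min_le_left _ _
  have c2 : min (l i) (t * m j) * ‖b‖ ^ 2 ≤ t * m j * ‖b‖ ^ 2 := by gcongr; exact min_le_right _ _
  nlinarith [mul_le_mul_of_nonneg_left hab hmin]

end Spectral

section Tensor

open Matrix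

variable {d : ℕ}

lemma tensorPow_mul (A B : Matrix (Fin d) (Fin d) ℂ) (n : ℕ) :
    tensorPow (A * B) n = tensorPow A n * tensorPow B n := by
  ext i j
  simp only [tensorPow, tensorSeq, Matrix.of_apply, Matrix.mul_apply, Fintype.prod_sum,
    Finset.prod_mul_distrib]

lemma tensorPow_conjTranspose (A : Matrix (Fin d) (Fin d) ℂ) (n : ℕ) :
    tensorPow Aᴴ n = (tensorPow A n)ᴴ := by
  ext i j
  simp [tensorPow, tensorSeq, conjTranspose_apply]

lemma tensorPow_diagonal (l : Fin d → ℂ) (n : ℕ) :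
    tensorPow (diagonal l) n = diagonal (fun i => ∏ k, l (i k)) := by
  ext i j
  simp only [tensorPow, tensorSeq, Matrix.of_apply]
  by_cases h : i = j
  · subst h; simp
  · obtain ⟨k, hk⟩ := Function.ne_iff.1 h
    rw [diagonal_apply_ne _ h]
    exact Finset.prod_eq_zero (Finset.mem_univ k) (diagonal_apply_ne _ hk)

lemma tensorPow_one (n : ℕ) : tensorPow (1 : Matrix (Fin d) (Fin d) ℂ) n = 1 := by
  rw [← diagonal_one, tensorPow_diagonal]; simp

lemma tensorPow_mem_unitaryGroup {U : Matrix (Fin d) (Fin d) ℂ} (hU : U ∈ unitaryGroup (Fin d) ℂ)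
    (n : ℕ) : tensorPow U n ∈ unitaryGroup (Fin n → Fin d) ℂ := by
  rw [mem_unitaryGroup_iff, star_eq_conjTranspose, ← tensorPow_conjTranspose, ← tensorPow_mul,
    ← star_eq_conjTranspose, mem_unitaryGroup_iff.1 hU, tensorPow_one]

lemma tensorPow_conjDiag (U : Matrix (Fin d) (Fin d) ℂ) (l : Fin d → ℝ) (n : ℕ) :
    tensorPow (conjDiag U l) n = conjDiag (tensorPow U n) (fun i => ∏ k, l (i k)) := by
  simp [conjDiag, tensorPow_mul, tensorPow_diagonal, tensorPow_conjTranspose]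

lemma matFun_eq_conjDiag {A : Matrix (Fin d) (Fin d) ℂ} (hA : A.IsHermitian) (f : ℝ → ℝ) :
    matFun f A = conjDiag hA.eigenvectorUnitary (fun i => f (hA.eigenvalues i)) := by
  rw [matFun, dif_pos hA, IsHermitian.cfc, Unitary.conjStarAlgAut_apply]
  rfl

lemma eq_conjDiag {A : Matrix (Fin d) (Fin d) ℂ} (hA : A.IsHermitian) :
    A = conjDiag hA.eigenvectorUnitary hA.eigenvalues := by
  conv_lhs => rw [hA.spectral_theorem, Unitary.conjStarAlgAut_apply]
  rfl

lemma overlap_eq_zero_of_suppLE {ρ σ U W : Matrix (Fin d) (Fin d) ℂ} {l m : Fin d → ℝ}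
    (hU : U ∈ unitaryGroup (Fin d) ℂ) (hW : W ∈ unitaryGroup (Fin d) ℂ)
    (hρ : ρ = conjDiag U l) (hσ : σ = conjDiag W m) (h : SuppLE ρ σ) {i j : Fin d}
    (hl : l i ≠ 0) (hm : m j = 0) : (Wᴴ * U) j i = 0 := by
  have hUU : Uᴴ * U = 1 := mem_unitaryGroup_iff'.1 hU
  have hWW : Wᴴ * W = 1 := mem_unitaryGroup_iff'.1 hW
  obtain ⟨C, hC⟩ : ∃ C, ρ = σ * C := by
    have : ∀ k, ∃ v, σ *ᵥ v = ρ *ᵥ Pi.single k 1 := fun k => by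
      have := h (LinearMap.mem_range_self (toLin' ρ) (Pi.single k 1))
      simpa [LinearMap.mem_range] using this
    choose v hv using this
    refine ⟨(of v)ᵀ, ?_⟩
    ext a b
    have := congrFun (hv b) a
    rw [mulVec_single_one] at this
    exact this.symm
  have e : (Wᴴ * U) * diagonal (fun i => (l i : ℂ))
      = diagonal (fun j => (m j : ℂ)) * (Wᴴ * C * U) := by
    calc _ = Wᴴ * ρ * U := by
          rw [hρ, conjDiag]
          simp only [Matrix.mul_assoc, hUU, Matrix.mul_one]
      _ = (Wᴴ * W) * diagonal (fun j => (m j : ℂ)) * (Wᴴ * C * U) := by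
          rw [hC, hσ, conjDiag]
          simp only [Matrix.mul_assoc]
      _ = _ := by rw [hWW, Matrix.one_mul]
  have := congrFun (congrFun e j) i
  rw [mul_diagonal, diagonal_mul, hm] at this
  simpa [hl] using this

end Tensor

section Converse

open Matrix

variable {d : ℕ}

/-- Joint distribution `l i |⟨wⱼ, uᵢ⟩|²` of Nussbaum and Szkoła, with `G j i = ⟨wⱼ, uᵢ⟩`. -/
def nsWeight (G : Matrix (Fin d) (Fin d) ℂ) (l : Fin d → ℝ) (x : Fin d × Fin d) : ℝ :=
  l x.1 * ‖G x.2 x.1‖ ^ 2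

/-- Centred log-likelihood ratio `D - log l i + log m j`. -/
def nsLoss (D : ℝ) (l m : Fin d → ℝ) (x : Fin d × Fin d) : ℝ :=
  D - (Real.log (l x.1) - Real.log (m x.2))

lemma nsWeight_nonneg (G : Matrix (Fin d) (Fin d) ℂ) {l : Fin d → ℝ} (hl : ∀ i, 0 ≤ l i)
    (x : Fin d × Fin d) : 0 ≤ nsWeight G l x :=
  mul_nonneg (hl _) (by positivity)

lemma tailWeight_nsWeight_le {G : Matrix (Fin d) (Fin d) ℂ} {l m : Fin d → ℝ}
    (hl : ∀ i, 0 ≤ l i) (hm : ∀ i, 0 ≤ m i) (hG : ∀ i j, l i ≠ 0 → m j = 0 → G j i = 0)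
    (D y : ℝ) (n : ℕ) :
    tailWeight (nsWeight G l) (nsLoss D l m) n (n * y) ≤
      ∑ i : Fin n → Fin d, ∑ j : Fin n → Fin d,
        min (∏ k, l (i k)) (Real.exp (n * (D - y)) * ∏ k, m (j k)) * ‖tensorPow G n j i‖ ^ 2 := by
  rw [tailWeight, ← Fintype.sum_prod_type',
    ← (Equiv.arrowProdEquivProdArrow (Fin n) (fun _ => Fin d) (fun _ => Fin d)).sum_comp]
  refine Finset.sum_le_sum fun ω _ => ?_
  simp only [Equiv.arrowProdEquivProdArrow_apply]
  have hmin : 0 ≤ min (∏ k, l (ω k).1) (Real.exp (n * (D - y)) * ∏ k, m (ω k).2) :=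
    le_min (Finset.prod_nonneg fun _ _ => hl _)
      (mul_nonneg (Real.exp_pos _).le (Finset.prod_nonneg fun _ _ => hm _))
  have hrhs := mul_nonneg hmin (sq_nonneg ‖tensorPow G n (fun k => (ω k).2) (fun k => (ω k).1)‖)
  split_ifs with hS
  · by_cases h0 : ∏ k, nsWeight G l (ω k) = 0
    · rw [h0]; exact hrhs
    have hw : ∀ k, nsWeight G l (ω k) ≠ 0 := fun k => Finset.prod_ne_zero_iff.1 h0 k (Finset.mem_univ k)
    have hlpos : ∀ k, 0 < l (ω k).1 := fun k =>
      (hl _).lt_of_ne' (left_ne_zero_of_mul (hw k))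
    have hmpos : ∀ k, 0 < m (ω k).2 := fun k =>
      (hm _).lt_of_ne' fun h => by
        have := hG _ _ (hlpos k).ne' h
        exact hw k (by simp [nsWeight, this])
    have hle : ∏ k, l (ω k).1 ≤ Real.exp (n * (D - y)) * ∏ k, m (ω k).2 := by
      have hlprod := Finset.prod_pos fun k (_ : k ∈ Finset.univ) => hlpos k
      have hmprod := Finset.prod_pos fun k (_ : k ∈ Finset.univ) => hmpos k
      rw [← Real.log_le_log_iff hlprod (mul_pos (Real.exp_pos _) hmprod),
        Real.log_mul (Real.exp_pos _).ne' hmprod.ne', Real.log_exp,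
        Real.log_prod fun k _ => (hlpos k).ne', Real.log_prod fun k _ => (hmpos k).ne']
      simp only [nsLoss, Finset.sum_sub_distrib, Finset.sum_const, Finset.card_univ,
        Fintype.card_fin, nsmul_eq_mul] at hS
      linarith
    rw [min_eq_left hle]
    simp only [nsWeight, tensorPow, tensorSeq, Matrix.of_apply, norm_prod, Finset.prod_mul_distrib,
      Finset.prod_pow, le_refl]
  · exact hrhs

lemma hypoErr_le_one {ι : Type} [Fintype ι] [DecidableEq ι] {ρ : Matrix ι ι ℂ}
    (hρ1 : reTr ρ = 1) {μ : ℝ} (hμ : 0 ≤ μ) (σ : Matrix ι ι ℂ)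
    (hnn : ∀ B : Matrix ι ι ℂ, B.PosSemidef → 0 ≤ reTr (B * ρ)) : hypoErr ρ σ μ ≤ 1 := by
  refine csInf_le ⟨0, ?_⟩ ⟨0, PosSemidef.zero, by simpa using PosSemidef.one, by simpa [reTr], by simp [hρ1]⟩
  rintro _ ⟨Q, -, h, -, rfl⟩
  exact hnn _ h

lemma hypoErr_nonneg {ι : Type} [Fintype ι] [DecidableEq ι] {ρ : Matrix ι ι ℂ}
    (σ : Matrix ι ι ℂ) (μ : ℝ)
    (hnn : ∀ B : Matrix ι ι ℂ, B.PosSemidef → 0 ≤ reTr (B * ρ)) : 0 ≤ hypoErr ρ σ μ := by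
  refine Real.sInf_nonneg ?_
  rintro _ ⟨Q, -, h, -, rfl⟩
  exact hnn _ h

lemma le_hypoErr_tensorPow {U W : Matrix (Fin d) (Fin d) ℂ} {l m : Fin d → ℝ}
    (hU : U ∈ unitaryGroup (Fin d) ℂ) (hW : W ∈ unitaryGroup (Fin d) ℂ)
    (hl : ∀ i, 0 ≤ l i) (hm : ∀ i, 0 ≤ m i)
    (hG : ∀ i j, l i ≠ 0 → m j = 0 → (Wᴴ * U) j i = 0) (D y : ℝ) {μ : ℝ} (hμ : 0 ≤ μ) (n : ℕ) :
    1 / 2 * tailWeight (nsWeight (Wᴴ * U) l) (nsLoss D l m) n (n * y) - Real.exp (n * (D - y)) * μ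
      ≤ hypoErr (tensorPow (conjDiag U l) n) (tensorPow (conjDiag W m) n) μ := by
  refine le_csInf ⟨_, 0, PosSemidef.zero, by simpa using PosSemidef.one, by simpa [reTr], rfl⟩ ?_
  rintro _ ⟨Q, hQ, hQ1, hβ, rfl⟩
  rw [tensorPow_conjDiag] at hβ ⊢
  have h := sum_min_le_bayesError hQ hQ1 (tensorPow_mem_unitaryGroup hU n)
    (tensorPow_mem_unitaryGroup hW n) (l := fun i => ∏ k, l (i k))
    (m := fun i => ∏ k, m (i k)) (fun i => Finset.prod_nonneg fun k _ => hl (i k))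
    (fun i => Finset.prod_nonneg fun k _ => hm (i k)) (Real.exp_pos (n * (D - y))).le
  rw [← tensorPow_conjTranspose, ← tensorPow_mul] at h
  have h' := tailWeight_nsWeight_le hl hm hG D y n
  have := mul_le_mul_of_nonneg_left hβ (Real.exp_pos (n * (D - y))).le
  linarith

lemma qD_eq_sum {ρ σ : Matrix (Fin d) (Fin d) ℂ} (hρ : ρ.IsHermitian) (hσ : σ.IsHermitian) :
    qD ρ σ = ∑ i, ∑ j, hρ.eigenvalues i * (Real.log (hρ.eigenvalues i) - Real.log (hσ.eigenvalues j)) *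
      ‖((hσ.eigenvectorUnitary : Matrix (Fin d) (Fin d) ℂ)ᴴ * hρ.eigenvectorUnitary) j i‖ ^ 2 := by
  have hU := hρ.eigenvectorUnitary.2
  have hW := hσ.eigenvectorUnitary.2
  rw [qD, mlog, mlog, matFun_eq_conjDiag hρ, matFun_eq_conjDiag hσ]
  nth_rw 1 [eq_conjDiag hρ]
  set U : Matrix (Fin d) (Fin d) ℂ := hρ.eigenvectorUnitary.1
  set W : Matrix (Fin d) (Fin d) ℂ := hσ.eigenvectorUnitary.1
  rw [Matrix.mul_sub, conjDiag_mul hU, ← Matrix.mul_one (conjDiag U fun i => _ * Real.log _),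
    ← conjDiag_one hW, reTr, trace_sub, Complex.sub_re, ← reTr, ← reTr,
    reTr_conjDiag_mul_conjDiag, reTr_conjDiag_mul_conjDiag]
  simp only [← Finset.sum_sub_distrib]
  exact Finset.sum_congr rfl fun i _ => Finset.sum_congr rfl fun j _ => by ring

lemma qV_eq_sum {ρ σ : Matrix (Fin d) (Fin d) ℂ} (hρ : ρ.IsHermitian) (hσ : σ.IsHermitian) :
    qV ρ σ = ∑ i, ∑ j, hρ.eigenvalues i *
      (Real.log (hρ.eigenvalues i) - Real.log (hσ.eigenvalues j)) ^ 2 *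
      ‖((hσ.eigenvectorUnitary : Matrix (Fin d) (Fin d) ℂ)ᴴ * hρ.eigenvectorUnitary) j i‖ ^ 2
      - qD ρ σ ^ 2 := by
  have hU := hρ.eigenvectorUnitary.2
  have hW := hσ.eigenvectorUnitary.2
  rw [qV, mlog, mlog, matFun_eq_conjDiag hρ, matFun_eq_conjDiag hσ]
  congr 1
  nth_rw 1 [eq_conjDiag hρ]
  set U : Matrix (Fin d) (Fin d) ℂ := hρ.eigenvectorUnitary.1
  set W : Matrix (Fin d) (Fin d) ℂ := hσ.eigenvectorUnitary.1
  set l := hρ.eigenvalues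
  set m := hσ.eigenvalues
  have e : reTr (conjDiag U l * (conjDiag U (fun i => Real.log (l i))
        - conjDiag W (fun i => Real.log (m i))) ^ 2)
      = reTr (conjDiag U (fun i => l i * Real.log (l i) ^ 2) * conjDiag W (fun _ => 1))
        - 2 * reTr (conjDiag U (fun i => l i * Real.log (l i)) * conjDiag W (fun j => Real.log (m j)))
        + reTr (conjDiag U l * conjDiag W (fun j => Real.log (m j) ^ 2)) := by
    set P := conjDiag U l
    set A := conjDiag U (fun i => Real.log (l i)) with hA
    set B := conjDiag W (fun i => Real.log (m i))
    have h1 : conjDiag U (fun i => l i * Real.log (l i) ^ 2) * conjDiag W (fun _ => 1)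
        = P * A * A := by
      rw [conjDiag_one hW, Matrix.mul_one, conjDiag_mul hU, conjDiag_mul hU]
      congr 1; funext i; ring
    have h2 : conjDiag U (fun i => l i * Real.log (l i)) = P * A := (conjDiag_mul hU _ _).symm
    have h2' : conjDiag U (fun i => l i * Real.log (l i)) = A * P := by
      rw [conjDiag_mul hU]; congr 1; funext i; ring
    have h3 : conjDiag W (fun j => Real.log (m j) ^ 2) = B * B := by
      rw [conjDiag_mul hW]; congr 1; funext i; ring
    have hcomm : (P * B * A).trace = (P * A * B).trace := by
      rw [← h2, h2', trace_mul_comm, Matrix.mul_assoc]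
    rw [h1, h2, h3]
    have : P * (A - B) ^ 2 = P * A * A - P * A * B - P * B * A + P * (B * B) := by
      rw [sq]; noncomm_ring
    rw [this]
    simp only [reTr, trace_add, trace_sub, hcomm, Complex.add_re, Complex.sub_re]
    ring
  rw [e]
  simp only [reTr_conjDiag_mul_conjDiag, Finset.mul_sum, ← Finset.sum_sub_distrib,
    ← Finset.sum_add_distrib]
  exact Finset.sum_congr rfl fun i _ => Finset.sum_congr rfl fun j _ => by ring

lemma sum_eigenvalues_mul_overlap {ρ : Matrix (Fin d) (Fin d) ℂ} (hρ : ρ.IsHermitian)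
    {W : Matrix (Fin d) (Fin d) ℂ} (hW : W ∈ unitaryGroup (Fin d) ℂ) :
    ∑ i, ∑ j, hρ.eigenvalues i *
      ‖(Wᴴ * (hρ.eigenvectorUnitary : Matrix (Fin d) (Fin d) ℂ)) j i‖ ^ 2 = reTr ρ := by
  conv_rhs => rw [← Matrix.mul_one ρ, eq_conjDiag hρ, ← conjDiag_one hW, reTr_conjDiag_mul_conjDiag]
  simp

/-- Lower bound on the optimal error in the moderate deviation regime. -/
lemma eventually_exp_le_hypoErr {ρ σ : Matrix (Fin d) (Fin d) ℂ}
    (hρ : IsDensity ρ) (hσ : IsDensity σ) (hsupp : SuppLE ρ σ) (hV : 0 < qV ρ σ)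
    {a : ℕ → ℝ} (ha0 : Tendsto a atTop (nhds 0))
    (ha1 : Tendsto (fun n : ℕ => a n * Real.sqrt n) atTop atTop)
    {δ : ℝ} (hδ : 0 < δ) (hδ1 : δ ≤ 1) :
    ∀ᶠ n : ℕ in atTop, Real.exp (-(n * a n ^ 2 / qV ρ σ * (1 / 2 + 23 * δ))) ≤
      hypoErr (tensorPow ρ n) (tensorPow σ n) (Real.exp (-(n : ℝ) * (qD ρ σ - a n))) := by
  have hρH := hρ.1.1
  have hσH := hσ.1.1
  have hU := hρH.eigenvectorUnitary.2
  have hW := hσH.eigenvectorUnitary.2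
  set U : Matrix (Fin d) (Fin d) ℂ := hρH.eigenvectorUnitary.1 with hUdef
  set W : Matrix (Fin d) (Fin d) ℂ := hσH.eigenvectorUnitary.1 with hWdef
  set l := hρH.eigenvalues with hldef
  set m := hσH.eigenvalues with hmdef
  have hl : ∀ i, 0 ≤ l i := hρ.1.eigenvalues_nonneg
  have hm : ∀ i, 0 ≤ m i := hσ.1.eigenvalues_nonneg
  have eρ : ρ = conjDiag U l := eq_conjDiag hρH
  have eσ : σ = conjDiag W m := eq_conjDiag hσH
  have hG : ∀ i j, l i ≠ 0 → m j = 0 → (Wᴴ * U) j i = 0 := fun i j =>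
    overlap_eq_zero_of_suppLE hU hW eρ eσ hsupp
  have hD := qD_eq_sum hρH hσH
  have hVs := qV_eq_sum hρH hσH
  have h1 := sum_eigenvalues_mul_overlap hρH hW
  rw [show reTr ρ = 1 by simp [reTr, hρ.2]] at h1
  rw [← hUdef, ← hWdef, ← hldef, ← hmdef] at hD hVs
  rw [← hUdef, ← hldef] at h1
  set D := qD ρ σ
  set V := qV ρ σ
  set w := nsWeight (Wᴴ * U) l with hwdef
  set X := nsLoss D l m with hXdef
  have w1 : ∑ x, w x = 1 := by
    rw [Fintype.sum_prod_type]; exact h1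
  have wL : ∑ x, w x * (Real.log (l x.1) - Real.log (m x.2)) = D := by
    rw [Fintype.sum_prod_type, hD]
    exact Finset.sum_congr rfl fun i _ => Finset.sum_congr rfl fun j _ => by
      simp only [hwdef, nsWeight]; ring
  have wL2 : ∑ x, w x * (Real.log (l x.1) - Real.log (m x.2)) ^ 2 = V + D ^ 2 := by
    rw [Fintype.sum_prod_type, hVs, sub_add_cancel]
    exact Finset.sum_congr rfl fun i _ => Finset.sum_congr rfl fun j _ => by
      simp only [hwdef, nsWeight]; ring
  have wX : ∑ x, w x * X x = 0 := by
    calc ∑ x, w x * X x = D * ∑ x, w x - ∑ x, w x * (Real.log (l x.1) - Real.log (m x.2)) := by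
          rw [Finset.mul_sum, ← Finset.sum_sub_distrib]
          exact Finset.sum_congr rfl fun x _ => by simp only [hXdef, nsLoss]; ring
      _ = 0 := by rw [w1, wL]; ring
  have wX2 : ∑ x, w x * X x ^ 2 = V := by
    calc ∑ x, w x * X x ^ 2
        = D ^ 2 * ∑ x, w x - 2 * D * ∑ x, w x * (Real.log (l x.1) - Real.log (m x.2))
          + ∑ x, w x * (Real.log (l x.1) - Real.log (m x.2)) ^ 2 := by
          rw [Finset.mul_sum, Finset.mul_sum, ← Finset.sum_sub_distrib, ← Finset.sum_add_distrib]
          exact Finset.sum_congr rfl fun x _ => by simp only [hXdef, nsLoss]; ring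
      _ = V := by rw [w1, wL, wL2]; ring
  have hna : Tendsto (fun n : ℕ => (n : ℝ) * a n ^ 2) atTop atTop := by
    refine (ha1.atTop_mul_atTop₀ ha1).congr fun n => ?_
    rw [mul_mul_mul_comm, Real.mul_self_sqrt n.cast_nonneg]; ring
  have hapos : ∀ᶠ n in atTop, 0 < a n := by
    filter_upwards [ha1.eventually_gt_atTop 0] with n hn
    exact pos_of_mul_pos_left hn (Real.sqrt_nonneg _)
  have hny : Tendsto (fun n : ℕ => (n : ℝ) * ((1 + δ) * a n) ^ 2) atTop atTop := by
    refine (hna.const_mul_atTop (show 0 < (1 + δ) ^ 2 by positivity)).congr fun n => ?_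
    ring
  have htail := eventually_exp_le_tailWeight (nsWeight_nonneg (Wᴴ * U) hl) w1 wX wX2 hV
    (y := fun n => (1 + δ) * a n) (by simpa using ha0.const_mul (1 + δ))
    (hapos.mono fun n hn => by positivity) hny hδ hδ1
  have hsmall : ∀ᶠ n in atTop, a n * ((1 + δ) ^ 2 * (1 / 2 + 5 * δ) / V) ≤ δ / 2 := by
    have := ha0.mul_const ((1 + δ) ^ 2 * (1 / 2 + 5 * δ) / V)
    rw [zero_mul] at this
    exact (this.eventually (gt_mem_nhds (half_pos hδ))).mono fun _ => le_of_lt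
  filter_upwards [htail, hapos, hsmall, ha0.eventually (gt_mem_nhds one_pos),
    hna.eventually_ge_atTop (Real.log 4 / (δ / 2)),
    hna.eventually_ge_atTop (V * (Real.log 4 / δ))] with n ht hpos hs hlt1 hb1 hb2
  have hmain := le_hypoErr_tensorPow hU hW hl hm hG D ((1 + δ) * a n)
    (Real.exp_pos (-(n : ℝ) * (D - a n))).le n
  rw [← eρ, ← eσ] at hmain
  refine le_trans ?_ hmain
  rw [← Real.exp_add]
  set E := Real.exp (-(n * ((1 + δ) * a n) ^ 2 / V * (1 / 2 + 5 * δ))) with hE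
  have e4 : E / 4 = Real.exp (-(n * ((1 + δ) * a n) ^ 2 / V * (1 / 2 + 5 * δ)) - Real.log 4) := by
    rw [Real.exp_sub, Real.exp_log (by norm_num)]
  have hn0 : (0 : ℝ) ≤ n := n.cast_nonneg
  have hb : Real.exp (n * (D - (1 + δ) * a n) + -(n : ℝ) * (D - a n)) ≤ E / 4 := by
    rw [e4]
    refine Real.exp_le_exp.2 ?_
    have c1 := mul_le_mul_of_nonneg_left hs (mul_nonneg hn0 hpos.le)
    have c2 : n * ((1 + δ) * a n) ^ 2 / V * (1 / 2 + 5 * δ)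
        = n * a n * (a n * ((1 + δ) ^ 2 * (1 / 2 + 5 * δ) / V)) := by ring
    have c3 : (n : ℝ) * a n ^ 2 ≤ n * a n :=
      mul_le_mul_of_nonneg_left (by nlinarith) hn0
    have c4 : Real.log 4 ≤ n * a n * (δ / 2) := by
      rw [← div_le_iff₀ (by positivity)]; exact hb1.trans c3
    rw [c2]
    linarith
  have hfin : Real.exp (-(n * a n ^ 2 / V * (1 / 2 + 23 * δ))) ≤ E / 4 := by
    rw [e4]
    refine Real.exp_le_exp.2 ?_
    set T := n * a n ^ 2 / V with hT
    have hT0 : 0 ≤ T := by positivity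
    have c1 : n * ((1 + δ) * a n) ^ 2 / V * (1 / 2 + 5 * δ) = T * ((1 + δ) ^ 2 * (1 / 2 + 5 * δ)) := by
      rw [hT]; ring
    have c2 : Real.log 4 ≤ T * δ := by
      rw [← div_le_iff₀ (by positivity), hT, le_div_iff₀ hV]; linarith
    have hδ2 : δ ^ 2 ≤ δ := by rw [sq]; exact mul_le_of_le_one_right hδ.le hδ1
    have hδ3 : δ ^ 3 ≤ δ := by
      rw [pow_succ]; exact (mul_le_mul_of_nonneg_right hδ2 hδ.le).trans (by rwa [← sq])
    have c3 : 0 ≤ T * (1 / 2 + 22 * δ - (1 + δ) ^ 2 * (1 / 2 + 5 * δ)) :=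
      mul_nonneg hT0 (by linarith)
    rw [c1]
    linarith
  linarith

end Converse

/-- **Moderate deviation converse for quantum hypothesis testing.** -/
theorem moderate_deviation_converse_HT
    {d : ℕ} (ρ σ : Matrix (Fin d) (Fin d) ℂ)
    (hρ : IsDensity ρ) (hσ : IsDensity σ) (hsupp : SuppLE ρ σ)
    (hV : 0 < qV ρ σ)
    (a : ℕ → ℝ)
    (ha0 : Filter.Tendsto a Filter.atTop (nhds 0))
    (ha1 : Filter.Tendsto (fun n : ℕ => a n * Real.sqrt n) Filter.atTop Filter.atTop) :
    Filter.liminf (fun n : ℕ => (1 / ((n : ℝ) * (a n) ^ 2)) *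
        Real.log (hypoErr (tensorPow ρ n) (tensorPow σ n)
          (Real.exp (-(n : ℝ) * (qD ρ σ - a n))))) Filter.atTop ≥
      -1 / (2 * qV ρ σ) := by
  set V := qV ρ σ with hVdef
  have hρH := hρ.1.1
  have hl := hρ.1.eigenvalues_nonneg
  have hnn : ∀ n (B : Matrix (Fin n → Fin d) (Fin n → Fin d) ℂ), B.PosSemidef →
      0 ≤ reTr (B * tensorPow ρ n) := fun n B hB => by
    rw [eq_conjDiag hρH, tensorPow_conjDiag]
    exact reTr_mul_conjDiag_nonneg hB _ fun i => Finset.prod_nonneg fun k _ => hl _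
  have htr : ∀ n, reTr (tensorPow ρ n) = 1 := fun n => by
    have : (tensorPow ρ n).trace = ρ.trace ^ n := by
      simp only [Matrix.trace, Matrix.diag_apply, tensorPow, tensorSeq, Matrix.of_apply,
        Finset.sum_pow', Fintype.piFinset_univ]
    rw [reTr, this, hρ.2]; simp
  have hcob : Filter.IsCoboundedUnder (· ≥ ·) atTop (fun n : ℕ => (1 / ((n : ℝ) * (a n) ^ 2)) *
        Real.log (hypoErr (tensorPow ρ n) (tensorPow σ n)
          (Real.exp (-(n : ℝ) * (qD ρ σ - a n))))) := by
    refine Filter.IsBoundedUnder.isCoboundedUnder_ge ⟨0, ?_⟩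
    refine Filter.eventually_map.2 (Filter.Eventually.of_forall fun n => ?_)
    exact mul_nonpos_of_nonneg_of_nonpos (by positivity)
      (Real.log_nonpos (hypoErr_nonneg _ _ (hnn n))
        (hypoErr_le_one (htr n) (Real.exp_pos _).le _ (hnn n)))
  refine le_of_forall_pos_sub_le fun ε hε => ?_
  refine Filter.le_liminf_of_le hcob ?_
  set δ := min 1 (ε * V / 23) with hδdef
  have hδ : 0 < δ := lt_min one_pos (by positivity)
  have hδε : 23 * δ ≤ ε * V := by
    have := min_le_right 1 (ε * V / 23)
    rw [← hδdef] at this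
    linarith
  have hpos : ∀ᶠ n : ℕ in atTop, 0 < (n : ℝ) * a n ^ 2 := by
    filter_upwards [ha1.eventually_gt_atTop 0] with n hn
    have : 0 < (a n * Real.sqrt n) ^ 2 := by positivity
    rwa [mul_pow, Real.sq_sqrt n.cast_nonneg, mul_comm] at this
  filter_upwards [eventually_exp_le_hypoErr hρ hσ hsupp hV ha0 ha1 hδ (min_le_left _ _), hpos]
    with n h hn
  have hlog := Real.log_le_log (Real.exp_pos _) h
  rw [Real.log_exp] at hlog
  have hstep : -1 / (2 * V) - ε ≤ -((1 / 2 + 23 * δ) / V) := by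
    have : (1 / 2 + 23 * δ) / V ≤ (1 / 2 + ε * V) / V := by gcongr
    have e : (1 / 2 + ε * V) / V = 1 / (2 * V) + ε := by field_simp
    rw [e] at this
    rw [neg_div]
    linarith
  refine hstep.trans (le_trans (le_of_eq ?_) (mul_le_mul_of_nonneg_left hlog (by positivity)))
  rw [← hVdef]
  generalize (n : ℝ) * a n ^ 2 = T at hn
  field_simp

end MDQ
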